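/- For any complex parameters α_0,…,α_5 with α_0+α_1+α_2+α_3+α_4+α_5 = 1, there is no rational solution (f_0,…,f_5) of A_5(α_0,…,α_5) such that for some i ∈ {0,…,5}, f_i, f_{i+1}, f_{i+2}, f_{i+3}, f_{i+4} have a pole at t=∞ and f_{i+5} is holomorphic at t=∞. -/

import Mathlib

open Filter Topology Polynomial

noncomputable section

/-- Evaluation of a complex rational function at a point (junk value where the
reduced denominator vanishes). -/
def evalR (f : RatFunc ℂ) (t : ℂ) : ℂ := RatFunc.eval (RingHom.id ℂ) t f

/-- `f` is defined at `t`: the reduced denominator does not vanish at `t`. -/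
def DefinedAt (f : RatFunc ℂ) (t : ℂ) : Prop := Polynomial.eval t (RatFunc.denom f) ≠ 0

/-- `(f 0, …, f 5)` is a rational solution of the `A₅⁽¹⁾` Painlevé system `A₅(α)`:
the two constraints hold identically as rational functions, and the six ODEs hold at
every point where all six components are defined.  (Indices are taken in `Fin 6`,
i.e. modulo `6`.) -/
def IsA5Solution (α : Fin 6 → ℂ) (f : Fin 6 → RatFunc ℂ) : Prop :=
  f 0 + f 2 + f 4 = RatFunc.X ∧
  f 1 + f 3 + f 5 = RatFunc.X ∧
  ∀ t : ℂ, (∀ j : Fin 6, DefinedAt (f j) t) → ∀ i : Fin 6,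
    t / 2 * deriv (evalR (f i)) t =
      evalR (f i) t *
        (evalR (f (i + 1)) t * evalR (f (i + 2)) t
          + evalR (f (i + 1)) t * evalR (f (i + 4)) t
          + evalR (f (i + 3)) t * evalR (f (i + 4)) t
          - evalR (f (i + 2)) t * evalR (f (i + 3)) t
          - evalR (f (i + 2)) t * evalR (f (i + 5)) t
          - evalR (f (i + 4)) t * evalR (f (i + 5)) t)
      + (1 / 2 - α (i + 2) - α (i + 4)) * evalR (f i) t
      + α i * (evalR (f (i + 2)) t + evalR (f (i + 4)) t)

/-- `f` has a pole at `t = ∞`: `‖f t‖ → ∞` as `‖t‖ → ∞`. -/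
def PoleAtInfty (f : RatFunc ℂ) : Prop :=
  Tendsto (fun t => ‖evalR f t‖) (Bornology.cobounded ℂ) atTop

/-- `f` is holomorphic at `t = ∞`: `f` is bounded as `‖t‖ → ∞`. -/
def HoloAtInfty (f : RatFunc ℂ) : Prop :=
  IsBoundedUnder (· ≤ ·) (Bornology.cobounded ℂ) fun t => ‖evalR f t‖

/-- `f` has a pole at `c ∈ ℂ`: `‖f t‖ → ∞` as `t → c`. -/
def PoleAt (f : RatFunc ℂ) (c : ℂ) : Prop :=
  Tendsto (fun t => ‖evalR f t‖) (𝓝[≠] c) atTop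

/-- `f` is regular at `c ∈ ℂ`: it extends continuously to `c`. -/
def RegularAt (f : RatFunc ℂ) (c : ℂ) : Prop :=
  ∃ L : ℂ, Tendsto (fun t => evalR f t) (𝓝[≠] c) (𝓝 L)

/-- `z` is an integer. -/
def IsInt (z : ℂ) : Prop := ∃ n : ℤ, z = (n : ℂ)

/-- `z` is an even integer. -/
def IsEvenInt (z : ℂ) : Prop := ∃ n : ℤ, z = 2 * (n : ℂ)

/-- A tuple of rational functions has pole configuration of Type A at `t = ∞`. -/
def TypeA (f : Fin 6 → RatFunc ℂ) : Prop :=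
  ∃ i : Fin 6,
    (PoleAtInfty (f i) ∧ PoleAtInfty (f (i + 1)) ∧ HoloAtInfty (f (i + 2)) ∧
      HoloAtInfty (f (i + 3)) ∧ HoloAtInfty (f (i + 4)) ∧ HoloAtInfty (f (i + 5))) ∨
    (PoleAtInfty (f i) ∧ PoleAtInfty (f (i + 3)) ∧ HoloAtInfty (f (i + 1)) ∧
      HoloAtInfty (f (i + 2)) ∧ HoloAtInfty (f (i + 4)) ∧ HoloAtInfty (f (i + 5))) ∨
    (PoleAtInfty (f i) ∧ PoleAtInfty (f (i + 1)) ∧ PoleAtInfty (f (i + 2)) ∧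
      PoleAtInfty (f (i + 4)) ∧ HoloAtInfty (f (i + 3)) ∧ HoloAtInfty (f (i + 5)))

/-- A tuple of rational functions has pole configuration of Type B at `t = ∞`. -/
def TypeB (f : Fin 6 → RatFunc ℂ) : Prop :=
  ∃ i : Fin 6,
    PoleAtInfty (f i) ∧ PoleAtInfty (f (i + 1)) ∧ PoleAtInfty (f (i + 2)) ∧
    PoleAtInfty (f (i + 3)) ∧ HoloAtInfty (f (i + 4)) ∧ HoloAtInfty (f (i + 5))


open Asymptotics in
/-- A quotient of polynomials with `deg p ≤ deg q` stays bounded at infinity. -/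
theorem isBigO_one_eval_div_eval {p q : ℂ[X]} (h : p.degree ≤ q.degree) :
    (fun t => p.eval t / q.eval t) =O[Bornology.cobounded ℂ] (1 : ℂ → ℂ) := by
  obtain ⟨c, hc⟩ := (isBigO_cobounded_of_degree_le h).bound
  refine IsBigO.of_bound (max c 0) ?_
  filter_upwards [hc] with t ht
  rw [norm_div, Pi.one_apply, norm_one, mul_one]
  refine div_le_of_le_mul₀ (norm_nonneg _) (le_max_right _ _) (ht.trans ?_)
  gcongr
  exact le_max_left _ _

theorem eventually_cobounded_eval_ne_zero {p : ℂ[X]} (hp : p ≠ 0) :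
    ∀ᶠ t in Bornology.cobounded ℂ, p.eval t ≠ 0 :=
  Bornology.le_cofinite ℂ (Polynomial.finite_setOfPred_isRoot hp).compl_mem_cofinite

theorem evalR_eq_div (f : RatFunc ℂ) (t : ℂ) : evalR f t = f.num.eval t / f.denom.eval t := rfl

theorem eventually_definedAt (f : RatFunc ℂ) :
    ∀ᶠ t in Bornology.cobounded ℂ, DefinedAt f t :=
  eventually_cobounded_eval_ne_zero f.denom_ne_zero

open Asymptotics in
theorem isBigO_one_mul {u v : ℂ → ℂ} (hu : u =O[Bornology.cobounded ℂ] (1 : ℂ → ℂ))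
    (hv : v =O[Bornology.cobounded ℂ] (1 : ℂ → ℂ)) :
    (fun t => u t * v t) =O[Bornology.cobounded ℂ] (1 : ℂ → ℂ) :=
  (hu.mul hv).congr_right fun _ => mul_one _

open Asymptotics in
theorem not_isBigO_one_of_tendsto_norm_atTop {u : ℂ → ℂ}
    (h : Tendsto (fun t => ‖u t‖) (Bornology.cobounded ℂ) atTop) :
    ¬ u =O[Bornology.cobounded ℂ] (1 : ℂ → ℂ) := by
  intro hu
  obtain ⟨c, hc⟩ := hu.bound
  obtain ⟨t, ht, ht'⟩ := (hc.and (h.eventually_gt_atTop c)).exists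
  simp only [Pi.one_apply, norm_one, mul_one] at ht
  exact absurd ht (not_le.2 ht')

open Asymptotics in
theorem tendsto_norm_sub_atTop {u v : ℂ → ℂ}
    (hu : Tendsto (fun t => ‖u t‖) (Bornology.cobounded ℂ) atTop)
    (hv : v =O[Bornology.cobounded ℂ] (1 : ℂ → ℂ)) :
    Tendsto (fun t => ‖u t - v t‖) (Bornology.cobounded ℂ) atTop := by
  obtain ⟨c, hc⟩ := hv.bound
  refine tendsto_atTop_mono' _ ?_ (tendsto_atTop_add_const_right _ (-c) hu)
  filter_upwards [hc] with t ht
  simp only [Pi.one_apply, norm_one, mul_one] at ht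
  linarith [norm_sub_norm_le (u t) (v t)]

theorem PoleAtInfty.degree_denom_lt_degree_num {f : RatFunc ℂ} (hf : PoleAtInfty f) :
    f.denom.degree < f.num.degree := by
  by_contra h
  exact not_isBigO_one_of_tendsto_norm_atTop hf (isBigO_one_eval_div_eval (not_lt.1 h))

theorem PoleAtInfty.num_ne_zero {f : RatFunc ℂ} (hf : PoleAtInfty f) : f.num ≠ 0 :=
  Polynomial.ne_zero_of_degree_gt hf.degree_denom_lt_degree_num

theorem PoleAtInfty.eventually_ne_zero {f : RatFunc ℂ} (hf : PoleAtInfty f) :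
    ∀ᶠ t in Bornology.cobounded ℂ, evalR f t ≠ 0 := by
  filter_upwards [eventually_cobounded_eval_ne_zero hf.num_ne_zero,
    eventually_definedAt f] with t h1 h2
  exact div_ne_zero h1 h2

theorem degree_X_mul_derivative_le (p : ℂ[X]) : (X * derivative p).degree ≤ p.degree := by
  by_cases hp : derivative p = 0
  · simp [hp]
  · have h := Polynomial.degree_derivative_lt (p := p) (by rintro rfl; simp at hp)
    rw [mul_comm, Polynomial.degree_mul_X]
    exact Nat.WithBot.add_one_le_of_lt h

open Asymptotics in
/-- The logarithmic derivative of a rational function decays like `t⁻¹` at infinity. -/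
theorem PoleAtInfty.isBigO_mul_deriv_div {f : RatFunc ℂ} (hf : PoleAtInfty f) :
    (fun t => t * deriv (evalR f) t / evalR f t) =O[Bornology.cobounded ℂ] (1 : ℂ → ℂ) := by
  refine ((isBigO_one_eval_div_eval (degree_X_mul_derivative_le f.num)).sub
    (isBigO_one_eval_div_eval (degree_X_mul_derivative_le f.denom))).congr' ?_ EventuallyEq.rfl
  filter_upwards [eventually_cobounded_eval_ne_zero hf.num_ne_zero,
    eventually_definedAt f] with t h1 h2
  have h2 : f.denom.eval t ≠ 0 := h2
  have h3 : deriv (evalR f) t = _ :=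
    ((f.num.hasDerivAt t).div (f.denom.hasDerivAt t) h2).deriv
  rw [h3, evalR_eq_div]
  simp only [eval_mul, eval_X]
  field_simp

open Asymptotics in
theorem PoleAtInfty.isBigO_div {f : RatFunc ℂ} (hf : PoleAtInfty f) :
    (fun t => t / evalR f t) =O[Bornology.cobounded ℂ] (1 : ℂ → ℂ) := by
  have h : (X * f.denom).degree ≤ f.num.degree := by
    rw [mul_comm, Polynomial.degree_mul_X]
    exact Nat.WithBot.add_one_le_of_lt hf.degree_denom_lt_degree_num
  refine (isBigO_one_eval_div_eval h).congr_left fun t => ?_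
  simp [evalR_eq_div, div_div_eq_mul_div]

open Asymptotics in
/-- If `(t / 2) df/dt = f P + k f + l (t - f)` near infinity and `f` has a pole there, then `P` is
bounded at infinity. -/
theorem PoleAtInfty.isBigO_of_ode {f : RatFunc ℂ} (hf : PoleAtInfty f) {P : ℂ → ℂ} {k l : ℂ}
    (h : ∀ᶠ t in Bornology.cobounded ℂ,
      t / 2 * deriv (evalR f) t = evalR f t * P t + k * evalR f t + l * (t - evalR f t)) :
    P =O[Bornology.cobounded ℂ] (1 : ℂ → ℂ) := by
  have hc : (fun _ : ℂ => l - k) =O[Bornology.cobounded ℂ] (1 : ℂ → ℂ) :=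
    isBigO_const_const _ one_ne_zero _
  refine (((hf.isBigO_mul_deriv_div.const_mul_left (1 / 2)).sub
    (hf.isBigO_div.const_mul_left l)).add hc).congr' ?_ EventuallyEq.rfl
  filter_upwards [h, hf.eventually_ne_zero] with t ht h0
  field_simp
  linear_combination 2 * ht

theorem IsA5Solution.shift {α : Fin 6 → ℂ} {f : Fin 6 → RatFunc ℂ} (h : IsA5Solution α f)
    (i : Fin 6) : IsA5Solution (fun k => α (i + k)) (fun k => f (i + k)) := by
  obtain ⟨h0, h1, h2⟩ := h
  refine ⟨?_, ?_, fun t ht j => ?_⟩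
  · fin_cases i <;> [rw [← h0]; rw [← h1]; rw [← h0]; rw [← h1]; rw [← h0]; rw [← h1]] <;>
      simp <;> ring
  · fin_cases i <;> [rw [← h1]; rw [← h0]; rw [← h1]; rw [← h0]; rw [← h1]; rw [← h0]] <;>
      simp <;> ring
  · simpa only [add_assoc] using h2 t (fun j => by simpa using ht (j - i)) (i + j)

theorem evalR_add_add_eq {f g h : RatFunc ℂ} (hX : f + g + h = RatFunc.X) :
    ∀ᶠ t in Bornology.cobounded ℂ, evalR f t + evalR g t + evalR h t = t := by
  filter_upwards [eventually_definedAt f, eventually_definedAt g, eventually_definedAt h,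
    eventually_definedAt (f + g)] with t hf hg hh hfg
  have := congrArg (evalR · t) hX
  simp only [evalR] at this ⊢
  rwa [RatFunc.eval_add _ _ hfg hh, RatFunc.eval_add _ _ hf hg, RatFunc.eval_X] at this

open Asymptotics in
theorem IsA5Solution.not_poles_of_holo {α : Fin 6 → ℂ} {f : Fin 6 → RatFunc ℂ}
    (h : IsA5Solution α f) (p0 : PoleAtInfty (f 0)) (p1 : PoleAtInfty (f 1))
    (p2 : PoleAtInfty (f 2)) (p3 : PoleAtInfty (f 3)) (p4 : PoleAtInfty (f 4))
    (p5 : HoloAtInfty (f 5)) : False := by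
  obtain ⟨hE, hO, hode⟩ := h
  have hE := evalR_add_add_eq hE
  have hO := evalR_add_add_eq hO
  have hdef : ∀ᶠ t in Bornology.cobounded ℂ, ∀ j, DefinedAt (f j) t :=
    eventually_all.2 fun j => eventually_definedAt (f j)
  set F : Fin 6 → ℂ → ℂ := fun j => evalR (f j) with hF
  set P : Fin 6 → ℂ → ℂ := fun i t => F (i + 1) t * F (i + 2) t + F (i + 1) t * F (i + 4) t
    + F (i + 3) t * F (i + 4) t - F (i + 2) t * F (i + 3) t - F (i + 2) t * F (i + 5) t
    - F (i + 4) t * F (i + 5) t with hP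
  have bound : ∀ i, PoleAtInfty (f i) → P i =O[Bornology.cobounded ℂ] (1 : ℂ → ℂ) := by
    intro i hi
    refine hi.isBigO_of_ode (k := 1 / 2 - α (i + 2) - α (i + 4)) (l := α i) ?_
    filter_upwards [hE, hO, hdef] with t hE hO hdef
    rw [hode t hdef i]
    have hsum : F i t + F (i + 2) t + F (i + 4) t = t := by
      fin_cases i <;> simp <;> first | linear_combination hE | linear_combination hO
    simp only [hP, hF] at hsum ⊢
    linear_combination α i * hsum
  have b0 := bound 0 p0
  have b1 := bound 1 p1
  have b2 := bound 2 p2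
  have b3 := bound 3 p3
  have b4 := bound 4 p4
  have hg : F 5 =O[Bornology.cobounded ℂ] (1 : ℂ → ℂ) :=
    (isBigO_one_iff ℂ).2 p5
  have hinv : (fun t : ℂ => t⁻¹) =O[Bornology.cobounded ℂ] (1 : ℂ → ℂ) :=
    tendsto_inv₀_cobounded.isBigO_one ℂ
  have hid : Tendsto (fun t : ℂ => ‖t‖) (Bornology.cobounded ℂ) atTop :=
    tendsto_norm_cobounded_atTop
  -- `F 1 - F 5` and the multiplier below both blow up, yet their product is bounded.
  have hdiff : Tendsto (fun t => ‖F 1 t - F 5 t‖) (Bornology.cobounded ℂ) atTop :=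
    tendsto_norm_sub_atTop p1 hg
  have hmult : Tendsto (fun t => ‖t - 2 * (P 3 t - P 1 t) * t⁻¹‖)
      (Bornology.cobounded ℂ) atTop :=
    tendsto_norm_sub_atTop hid
      (isBigO_one_mul ((b3.sub b1).const_mul_left 2) hinv)
  have hprod : Tendsto (fun t => ‖(F 1 t - F 5 t) * (t - 2 * (P 3 t - P 1 t) * t⁻¹)‖)
      (Bornology.cobounded ℂ) atTop := by
    simpa only [norm_mul] using hdiff.atTop_mul_atTop₀ hmult
  refine not_isBigO_one_of_tendsto_norm_atTop hprod ?_
  have hone : (fun _ : ℂ => (1 : ℂ)) =O[Bornology.cobounded ℂ] (1 : ℂ → ℂ) :=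
    isBigO_refl _ _
  have hfac := hone.sub ((isBigO_one_mul hg hinv).const_mul_left 2)
  have hlin := (b3.const_mul_left 3).add ((b0.add b2).add b4)
  have hrest := (b0.const_mul_left 2).sub (isBigO_one_mul hfac hlin)
  refine hrest.congr' ?_ EventuallyEq.rfl
  filter_upwards [hE, hO, hid.eventually_gt_atTop 0] with t hE hO ht
  have ht : t ≠ 0 := norm_pos_iff.1 ht
  have h4 : F 4 t = t - F 0 t - F 2 t := by linear_combination hE
  have h3 : F 3 t = t - F 1 t - F 5 t := by linear_combination hO
  simp only [hP, Fin.reduceAdd, zero_add, h3, h4]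
  field_simp
  ring

/-- Nonexistence of rational solutions with the given pole configuration at `t = ∞`. -/
theorem stmt_11 (α : Fin 6 → ℂ)
    (hsum : α 0 + α 1 + α 2 + α 3 + α 4 + α 5 = 1) :
    ¬ ∃ (f : Fin 6 → RatFunc ℂ) (i : Fin 6), IsA5Solution α f ∧
      PoleAtInfty (f i) ∧
      PoleAtInfty (f (i + 1)) ∧
      PoleAtInfty (f (i + 2)) ∧
      PoleAtInfty (f (i + 3)) ∧
      PoleAtInfty (f (i + 4)) ∧
      HoloAtInfty (f (i + 5)) := by
  rintro ⟨f, i, h, p0, p1, p2, p3, p4, p5⟩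
  exact (h.shift i).not_poles_of_holo (by simpa using p0) p1 p2 p3 p4 p5
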